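/- Let t ∈ ℂ with ‖t‖ < 1. Then the iterated normalized contour integral over |z| = 1 and |w| = 1, each against dμ_{SU(2)}, of PE_F[(z+1/z)(w+1/w); t] · PE_B[z+1/z; t] · PE_B[w+1/w; t] equals 1 − t³ + 3t⁴ − t⁵. This is the Hilbert–Poincaré series of SO(4)-invariant form polynomials in the supervielbein of the curved supercoset OSp(1|4)/SO(4), with vielbein and gravitino both assigned weight t. -/

import Mathlib

/-- Normalized contour integral `(2πi)⁻¹ ∮_{|z|=1} f(z) dz` over the positively
oriented unit circle. -/
noncomputable def cint (f : ℂ → ℂ) : ℂ :=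
  (2 * (Real.pi : ℂ) * Complex.I)⁻¹ * (∮ z in C(0, 1), f z)

/-- Normalized contour integral `∮ f(z) dz/(2πi z)`. -/
noncomputable def nint (f : ℂ → ℂ) : ℂ :=
  cint fun z => f z / z

/-- Bosonic plethystic exponential `PE_B[χ; t] = ∏_j (1 - t mⱼ)⁻¹`, for `χ` the
sum of the Laurent monomials `mⱼ` in the list `ms`. -/
noncomputable def PE_B (t : ℂ) (ms : List ℂ) : ℂ :=
  ((ms.map fun m => 1 - t * m).prod)⁻¹

/-- Fermionic plethystic exponential `PE_F[χ; t] = ∏_j (1 - t mⱼ)`. -/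
noncomputable def PE_F (t : ℂ) (ms : List ℂ) : ℂ :=
  (ms.map fun m => 1 - t * m).prod

open Complex Metric

lemma nint_congr {f g : ℂ → ℂ} (h : ∀ z ∈ sphere (0 : ℂ) 1, f z = g z) : nint f = nint g := by
  unfold nint cint
  congr 1
  exact circleIntegral.integral_congr zero_le_one fun z hz => by simp only [h z hz]

lemma ne_zero_of_mem_sphere_one {z : ℂ} (hz : z ∈ sphere (0 : ℂ) 1) : z ≠ 0 :=
  ne_zero_of_mem_unit_sphere ⟨z, hz⟩

lemma circleIntegrable_div_self {f : ℂ → ℂ} (hf : ContinuousOn f (sphere 0 1)) :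
    CircleIntegrable (fun z => f z / z) 0 1 :=
  (hf.div continuousOn_id fun _ hz => ne_zero_of_mem_sphere_one hz).circleIntegrable zero_le_one

lemma nint_add {f g : ℂ → ℂ} (hf : ContinuousOn f (sphere 0 1))
    (hg : ContinuousOn g (sphere 0 1)) : nint (fun z => f z + g z) = nint f + nint g := by
  unfold nint cint
  simp only [add_div]
  rw [circleIntegral.integral_add (circleIntegrable_div_self hf) (circleIntegrable_div_self hg),
    mul_add]

lemma nint_const_mul (c : ℂ) (f : ℂ → ℂ) : nint (fun z => c * f z) = c * nint f := by
  unfold nint cint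
  simp only [mul_div_assoc]
  rw [circleIntegral.integral_const_mul]
  ring

lemma nint_zpow (n : ℤ) : nint (fun z => z ^ n) = if n = 0 then 1 else 0 := by
  unfold nint cint
  have h : (∮ z in C(0, 1), z ^ n / z) = ∮ z in C((0 : ℂ), 1), (z - 0) ^ (n - 1) :=
    circleIntegral.integral_congr zero_le_one fun z hz => by
      simp only [sub_zero, zpow_sub_one₀ (ne_zero_of_mem_sphere_one hz), div_eq_mul_inv]
  rw [h]
  split_ifs with hn
  · subst hn
    have := circleIntegral.integral_sub_center_inv (0 : ℂ) one_ne_zero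
    simp only [zero_sub, zpow_neg_one, this]
    exact inv_mul_cancel₀ two_pi_I_ne_zero
  · rw [circleIntegral.integral_sub_zpow_of_ne (by omega), mul_zero]

/-- The Weyl measure density of `SU(2)` times the bosonic factor of a doublet. -/
noncomputable def doubletKernel (t z : ℂ) : ℂ := (1 - z ^ 2) * PE_B t [z, 1 / z]

section

variable {t : ℂ}

lemma one_sub_mul_ne_zero (ht : ‖t‖ < 1) {z : ℂ} (hz : ‖z‖ ≤ 1) : 1 - t * z ≠ 0 := by
  intro h
  have h1 : ‖t * z‖ = 1 := by rw [← sub_eq_zero.mp h, norm_one]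
  rw [norm_mul] at h1
  nlinarith [norm_nonneg t, norm_nonneg z]

lemma one_sub_mul_one_div_ne_zero (ht : ‖t‖ < 1) {z : ℂ} (hz : z ∈ sphere (0 : ℂ) 1) :
    1 - t * (1 / z) ≠ 0 :=
  one_sub_mul_ne_zero ht (by simp [mem_sphere_zero_iff_norm.mp hz])

lemma PE_B_doublet_mul (ht : ‖t‖ < 1) {z : ℂ} (hz : z ∈ sphere (0 : ℂ) 1) :
    (1 + t ^ 2 - t * (z + 1 / z)) * PE_B t [z, 1 / z] = 1 := by
  have h0 := ne_zero_of_mem_sphere_one hz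
  have h1 := one_sub_mul_ne_zero ht (mem_sphere_zero_iff_norm.mp hz).le
  have h2 := one_sub_mul_one_div_ne_zero ht hz
  have h : 1 + t ^ 2 - t * (z + 1 / z) = (1 - t * z) * (1 - t * (1 / z)) := by
    field_simp
    ring
  simp only [PE_B, List.map_cons, List.map_nil, List.prod_cons, List.prod_nil, mul_one, h]
  exact mul_inv_cancel₀ (mul_ne_zero h1 h2)

lemma PE_F_bidoublet {z w : ℂ} (hz : z ≠ 0) (hw : w ≠ 0) :
    PE_F t [z * w, z / w, w / z, 1 / (z * w)] =
      (1 + t ^ 2) ^ 2 - t * (1 + t ^ 2) * ((z + 1 / z) * (w + 1 / w)) +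
        t ^ 2 * ((z + 1 / z) ^ 2 + (w + 1 / w) ^ 2 - 4) := by
  simp only [PE_F, List.map_cons, List.map_nil, List.prod_cons, List.prod_nil, mul_one]
  field_simp
  ring

lemma continuousOn_add_one_div : ContinuousOn (fun z : ℂ => z + 1 / z) (sphere 0 1) :=
  continuousOn_id.add
    (continuousOn_const.div continuousOn_id fun _ hz => ne_zero_of_mem_sphere_one hz)

lemma continuousOn_doubletKernel (ht : ‖t‖ < 1) :
    ContinuousOn (doubletKernel t) (sphere 0 1) := by
  have h : ContinuousOn (fun z : ℂ => (1 - z ^ 2) / (1 + t ^ 2 - t * (z + 1 / z)))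
      (sphere 0 1) :=
    ContinuousOn.div (by fun_prop)
      (continuousOn_const.sub (continuousOn_const.mul continuousOn_add_one_div))
      fun z hz => left_ne_zero_of_mul_eq_one (PE_B_doublet_mul ht hz)
  refine h.congr fun z hz => ?_
  rw [doubletKernel, eq_inv_of_mul_eq_one_right (PE_B_doublet_mul ht hz)]
  exact (div_eq_mul_inv _ _).symm

lemma nint_quadratic_mul_doubletKernel (ht : ‖t‖ < 1) (a b c : ℂ) :
    nint (fun z => (a + b * (z + 1 / z) + c * (z + 1 / z) ^ 2) * doubletKernel t z) =
      a * nint (doubletKernel t) + b * nint (fun z => (z + 1 / z) * doubletKernel t z) +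
        c * nint (fun z => (z + 1 / z) ^ 2 * doubletKernel t z) := by
  have hK := continuousOn_doubletKernel ht
  have hx := continuousOn_add_one_div
  have hc (d : ℂ) {f : ℂ → ℂ} (hf : ContinuousOn f (sphere 0 1)) :
      ContinuousOn (fun z => d * f z) (sphere 0 1) := continuousOn_const.mul hf
  have h1 : ContinuousOn (fun z => (z + 1 / z) * doubletKernel t z) (sphere 0 1) := hx.mul hK
  have h2 : ContinuousOn (fun z => (z + 1 / z) ^ 2 * doubletKernel t z) (sphere 0 1) :=
    (hx.pow 2).mul hK
  have h01 : ContinuousOn (fun z => a * doubletKernel t z +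
      b * ((z + 1 / z) * doubletKernel t z)) (sphere 0 1) := (hc a hK).add (hc b h1)
  rw [← nint_const_mul, ← nint_const_mul, ← nint_const_mul, ← nint_add (hc a hK) (hc b h1),
    ← nint_add h01 (hc c h2)]
  congr 1
  ext z
  ring

lemma nint_doubletKernel (ht : ‖t‖ < 1) : nint (doubletKernel t) = 1 := by
  have hd : DifferentiableOn ℂ (fun z : ℂ => (1 - z ^ 2) / (1 - t * z)) (closedBall 0 1) :=
    DifferentiableOn.div (by fun_prop) (by fun_prop)
      fun z hz => one_sub_mul_ne_zero ht (mem_closedBall_zero_iff.mp hz)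
  have hc := hd.diffContOnCl_ball subset_rfl |>.circleIntegral_sub_inv_smul
    (mem_ball_zero_iff.mpr ht)
  have ht2 : 1 - t ^ 2 ≠ 0 := by
    simpa [sq] using one_sub_mul_ne_zero ht ht.le
  have h : (∮ z in C(0, 1), doubletKernel t z / z) =
      ∮ z in C((0 : ℂ), 1), (z - t)⁻¹ • ((1 - z ^ 2) / (1 - t * z)) :=
    circleIntegral.integral_congr zero_le_one fun z hz => by
      have h0 := ne_zero_of_mem_sphere_one hz
      have h1 := one_sub_mul_ne_zero ht (mem_sphere_zero_iff_norm.mp hz).le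
      have h2 : 1 - t / z ≠ 0 := by simpa [div_eq_mul_inv] using one_sub_mul_one_div_ne_zero ht hz
      have h3 : z - t = z * (1 - t / z) := by field_simp
      simp only [doubletKernel, PE_B, List.map_cons, List.map_nil, List.prod_cons, List.prod_nil,
        mul_one, smul_eq_mul, mul_one_div, h3]
      generalize 1 - t / z = u at h2 ⊢
      field_simp
  unfold nint cint
  rw [h, hc, ← sq, div_self ht2, smul_eq_mul, mul_one]
  exact inv_mul_cancel₀ two_pi_I_ne_zero

lemma nint_weyl : nint (fun z => 1 - z ^ 2) = 1 := by
  have h : nint (fun z => z ^ (0 : ℤ) + (-1) * z ^ (2 : ℤ)) = 1 := by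
    rw [nint_add (by simpa using continuousOn_const) (by norm_cast; fun_prop), nint_const_mul,
      nint_zpow, nint_zpow]
    norm_num
  refine (nint_congr fun z _ => ?_).trans h
  rw [zpow_zero, zpow_ofNat]
  ring

lemma nint_weyl_mul_character : nint (fun z => (1 - z ^ 2) * (z + 1 / z)) = 0 := by
  have hz (n : ℤ) : ContinuousOn (fun z : ℂ => z ^ n) (sphere 0 1) :=
    continuousOn_id.zpow₀ n fun _ hz => Or.inl (ne_zero_of_mem_sphere_one hz)
  have h : nint (fun z => z ^ (-1 : ℤ) + (-1) * z ^ (3 : ℤ)) = 0 := by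
    rw [nint_add (g := fun z => (-1) * z ^ (3 : ℤ)) (hz _) (continuousOn_const.mul (hz _)),
      nint_const_mul, nint_zpow, nint_zpow]
    norm_num
  refine (nint_congr fun z hz => ?_).trans h
  have h0 := ne_zero_of_mem_sphere_one hz
  rw [zpow_neg_one, zpow_ofNat]
  field_simp
  ring

lemma mul_nint_character_mul_doubletKernel (ht : ‖t‖ < 1) :
    t * nint (fun z => (z + 1 / z) * doubletKernel t z) = t ^ 2 := by
  have h := nint_quadratic_mul_doubletKernel ht (1 + t ^ 2) (-t) 0
  rw [nint_congr (g := fun z => 1 - z ^ 2) fun z hz => by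
      rw [doubletKernel]
      linear_combination (1 - z ^ 2) * PE_B_doublet_mul ht hz,
    nint_weyl, nint_doubletKernel ht] at h
  linear_combination h

lemma mul_nint_character_sq_mul_doubletKernel (ht : ‖t‖ < 1) :
    t * nint (fun z => (z + 1 / z) ^ 2 * doubletKernel t z) =
      (1 + t ^ 2) * nint (fun z => (z + 1 / z) * doubletKernel t z) := by
  have h := nint_quadratic_mul_doubletKernel ht 0 (1 + t ^ 2) (-t)
  rw [nint_congr (g := fun z => (1 - z ^ 2) * (z + 1 / z)) fun z hz => by
      rw [doubletKernel]
      linear_combination (1 - z ^ 2) * (z + 1 / z) * PE_B_doublet_mul ht hz,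
    nint_weyl_mul_character] at h
  linear_combination h

end

/-- Hilbert–Poincaré series of `SO(4)`-invariant form polynomials in the
supervielbein of the curved supercoset `OSp(1|4)/SO(4)`, with vielbein and
gravitino both assigned weight `t`. -/
theorem statement_5 (t : ℂ) (ht : ‖t‖ < 1) :
    (nint fun z => (1 - z ^ 2) *
      nint fun w => (1 - w ^ 2) *
        (PE_F t [z * w, z / w, w / z, 1 / (z * w)] *
         PE_B t [z, 1 / z] * PE_B t [w, 1 / w]))
      = 1 - t ^ 3 + 3 * t ^ 4 - t ^ 5 := by
  have h0 := nint_doubletKernel ht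
  have h1 := mul_nint_character_mul_doubletKernel ht
  have h2 := mul_nint_character_sq_mul_doubletKernel ht
  have hq := nint_quadratic_mul_doubletKernel ht
  set A₁ := nint (fun z => (z + 1 / z) * doubletKernel t z)
  set A₂ := nint (fun z => (z + 1 / z) ^ 2 * doubletKernel t z)
  rw [h0] at hq
  have hsq : t * A₁ ^ 2 = t ^ 3 := by
    rcases eq_or_ne t 0 with h | h
    · simp [h]
    · have : A₁ = t := mul_left_cancel₀ h (by rw [h1, sq])
      rw [this]
      ring
  have houter : ∀ z ∈ sphere (0 : ℂ) 1,
      ((1 - z ^ 2) * nint fun w => (1 - w ^ 2) *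
        (PE_F t [z * w, z / w, w / z, 1 / (z * w)] * PE_B t [z, 1 / z] * PE_B t [w, 1 / w])) =
      ((1 + t ^ 2) ^ 2 - 4 * t ^ 2 + t ^ 2 * A₂ + (-(t * (1 + t ^ 2) * A₁)) * (z + 1 / z) +
        t ^ 2 * (z + 1 / z) ^ 2) * doubletKernel t z := by
    intro z hz
    have hinner := nint_congr (f := fun w => (1 - w ^ 2) *
        (PE_F t [z * w, z / w, w / z, 1 / (z * w)] * PE_B t [z, 1 / z] * PE_B t [w, 1 / w]))
      (g := fun w => PE_B t [z, 1 / z] *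
        (((1 + t ^ 2) ^ 2 + t ^ 2 * ((z + 1 / z) ^ 2 - 4) +
          (-(t * (1 + t ^ 2) * (z + 1 / z))) * (w + 1 / w) + t ^ 2 * (w + 1 / w) ^ 2) *
            doubletKernel t w)) fun w hw => by
      rw [PE_F_bidoublet (ne_zero_of_mem_sphere_one hz) (ne_zero_of_mem_sphere_one hw),
        doubletKernel]
      ring
    rw [hinner, nint_const_mul, hq, doubletKernel]
    ring
  rw [nint_congr houter, hq]
  linear_combination (-(1 + t ^ 2)) * hsq + 2 * t * h2 + 2 * (1 + t ^ 2) * h1
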